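/- Suppose Assumption 1 holds, only D is mismeasured (Z'=Z and Y'=Y almost surely), the measurement error of D is non-differential with respect to the potential values (D' is independent of (Z, Y_1, Y_0, D_1, D_0) given D), all conditioning events have positive probability, P(U=c) > 0, r_D ≠ 0, and RD_{D'|Z} ≠ 0. Then P(Y_1=1|U=c) = RD_{YD'|Z}/RD_{D'|Z} − (1−SP_D)·RD_{Y|Z}/RD_{D'|Z}, and P(Y_0=1|U=c) = RD_{YD'|Z}/RD_{D'|Z} − SN_D·RD_{Y|Z}/RD_{D'|Z}. -/

import Mathlib

open MeasureTheory ProbabilityTheory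

noncomputable def pr {Ω : Type*} [MeasurableSpace Ω] (μ : MeasureTheory.Measure Ω)
    (A : Set Ω) : ℝ := (μ A).toReal

noncomputable def cpr {Ω : Type*} [MeasurableSpace Ω] (μ : MeasureTheory.Measure Ω)
    (B A : Set Ω) : ℝ := (ProbabilityTheory.cond μ B A).toReal

def bin01 : Set ℝ := {0, 1}

section Helpers

variable {Ω : Type*} [MeasurableSpace Ω] (μ : Measure Ω)

lemma cpr_eq_div {B : Set Ω} (hB : MeasurableSet B) (A : Set Ω) :
    cpr μ B A = pr μ (B ∩ A) / pr μ B := by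
  simp only [cpr, pr, cond_apply hB, ENNReal.toReal_mul, ENNReal.toReal_inv]
  ring

lemma pr_ne_zero [IsFiniteMeasure μ] {A : Set Ω} (hA : μ A ≠ 0) : pr μ A ≠ 0 :=
  ENNReal.toReal_ne_zero.2 ⟨hA, measure_ne_top _ _⟩

lemma pr_inter_eq_of_cpr_eq [IsFiniteMeasure μ] {B A A' : Set Ω} (hB : MeasurableSet B)
    (h : cpr μ B A = cpr μ B A') : pr μ (B ∩ A) = pr μ (B ∩ A') := by
  rw [cpr_eq_div μ hB, cpr_eq_div μ hB] at h
  by_cases h0 : μ B = 0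
  · simp [pr, measure_mono_null Set.inter_subset_left h0]
  · exact (div_left_inj' (pr_ne_zero μ h0)).1 h

lemma cpr_compl_binary [IsFiniteMeasure μ] {B : Set Ω} (hB : μ B ≠ 0) {X : Ω → ℝ}
    (hX : Measurable X) (hbin : ∀ ω, X ω = 0 ∨ X ω = 1) :
    cpr μ B {ω | X ω = 1} = 1 - cpr μ B {ω | X ω = 0} := by
  have : IsProbabilityMeasure (ProbabilityTheory.cond μ B) := cond_isProbabilityMeasure hB
  have hc : {ω | X ω = 1} = {ω | X ω = 0}ᶜ := by
    ext ω
    rcases hbin ω with h | h <;> simp [h]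
  rw [hc]
  exact probReal_compl_eq_one_sub (hX (measurableSet_singleton 0))

/-- The quadruples with entries in `{0, 1}`. -/
noncomputable def cells : Finset (ℝ × ℝ × ℝ × ℝ) :=
  ({0, 1} : Finset ℝ) ×ˢ ({0, 1} : Finset ℝ) ×ˢ ({0, 1} : Finset ℝ) ×ˢ ({0, 1} : Finset ℝ)

lemma sum_cells (f : ℝ × ℝ × ℝ × ℝ → ℝ) :
    ∑ v ∈ cells, f v =
      f (0, 0, 0, 0) + f (0, 0, 0, 1) + f (0, 0, 1, 0) + f (0, 0, 1, 1)
      + f (0, 1, 0, 0) + f (0, 1, 0, 1) + f (0, 1, 1, 0) + f (0, 1, 1, 1)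
      + f (1, 0, 0, 0) + f (1, 0, 0, 1) + f (1, 0, 1, 0) + f (1, 0, 1, 1)
      + f (1, 1, 0, 0) + f (1, 1, 0, 1) + f (1, 1, 1, 0) + f (1, 1, 1, 1) := by
  simp only [cells, Finset.sum_product, Finset.sum_pair (zero_ne_one (α := ℝ))]
  ring

lemma pr_eq_sum_cells [IsFiniteMeasure μ] {V : Ω → ℝ × ℝ × ℝ × ℝ} (hV : Measurable V)
    (hcells : ∀ ω, V ω ∈ cells) (A : Set Ω) :
    pr μ A = ∑ v ∈ cells, pr μ (A ∩ V ⁻¹' {v}) := by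
  have h := sum_measureReal_preimage_singleton (μ := μ.restrict A) cells (f := V)
    (fun v _ => hV (measurableSet_singleton v))
  have hU : V ⁻¹' (cells : Set (ℝ × ℝ × ℝ × ℝ)) = Set.univ :=
    Set.eq_univ_of_forall hcells
  rw [hU] at h
  have hA : pr μ A = (μ.restrict A).real Set.univ := by simp [pr, Measure.real]
  rw [hA, ← h]
  refine Finset.sum_congr rfl fun v _ => ?_
  rw [measureReal_restrict_apply (hV (measurableSet_singleton v)), Set.inter_comm]
  rfl

lemma pr_setOf_eq_sum_cells [IsFiniteMeasure μ] {V : Ω → ℝ × ℝ × ℝ × ℝ} (hV : Measurable V)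
    (hcells : ∀ ω, V ω ∈ cells) (p : ℝ × ℝ × ℝ × ℝ → Prop) [DecidablePred p] :
    pr μ {ω | p (V ω)} = ∑ v ∈ cells, if p v then pr μ (V ⁻¹' {v}) else 0 := by
  rw [pr_eq_sum_cells μ hV hcells]
  refine Finset.sum_congr rfl fun v _ => ?_
  split_ifs with h
  · congr 1
    ext ω
    simp only [Set.mem_inter_iff, Set.mem_ofPred_eq, Set.mem_preimage, Set.mem_singleton_iff,
      and_iff_right_iff_imp]
    rintro rfl
    exact h
  · have : {ω | p (V ω)} ∩ V ⁻¹' {v} = ∅ := by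
      ext ω
      simp only [Set.mem_inter_iff, Set.mem_ofPred_eq, Set.mem_preimage, Set.mem_singleton_iff,
        Set.mem_empty_iff_false, iff_false, not_and]
      rintro hp rfl
      exact h hp
    simp [this, pr]

/-- If, on `B`, the event `A` has mass `w v` times that of `B` inside each cell `V = v` where the
predicate `p` holds, then `P(p(V), A | B)` is the sum of the `w v` over the cells satisfying `p`. -/
lemma cpr_eq_sum_cells [IsFiniteMeasure μ] {V : Ω → ℝ × ℝ × ℝ × ℝ} (hV : Measurable V)
    (hcells : ∀ ω, V ω ∈ cells) {B : Set Ω} (hB : MeasurableSet B) (hB0 : μ B ≠ 0)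
    {A C : Set Ω} (p : ℝ × ℝ × ℝ × ℝ → Prop) [DecidablePred p]
    (hC : ∀ ω ∈ B, ω ∈ C ↔ p (V ω) ∧ ω ∈ A) {w : ℝ × ℝ × ℝ × ℝ → ℝ}
    (hw : ∀ v ∈ cells, pr μ (B ∩ V ⁻¹' {v} ∩ A) = pr μ B * w v) :
    cpr μ B C = ∑ v ∈ cells, if p v then w v else 0 := by
  rw [cpr_eq_div μ hB, div_eq_iff (pr_ne_zero μ hB0), pr_eq_sum_cells μ hV hcells, Finset.sum_mul]
  refine Finset.sum_congr rfl fun v hv => ?_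
  split_ifs with h
  · rw [mul_comm, ← hw v hv]
    congr 1
    ext ω
    simp only [Set.mem_inter_iff, Set.mem_preimage, Set.mem_singleton_iff]
    constructor
    · rintro ⟨⟨hb, hc⟩, rfl⟩
      exact ⟨⟨hb, rfl⟩, ((hC ω hb).1 hc).2⟩
    · rintro ⟨⟨hb, rfl⟩, ha⟩
      exact ⟨⟨hb, (hC ω hb).2 ⟨h, ha⟩⟩, rfl⟩
  · have : B ∩ C ∩ V ⁻¹' {v} = ∅ := by
      ext ω
      simp only [Set.mem_inter_iff, Set.mem_preimage, Set.mem_singleton_iff,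
        Set.mem_empty_iff_false, iff_false, not_and, and_imp]
      rintro hb hc rfl
      exact h ((hC ω hb).1 hc).1
    simp [this, pr]

end Helpers

set_option maxHeartbeats 1000000 in
theorem stmt8 {Ω : Type*} [MeasurableSpace Ω]
    (μ : MeasureTheory.Measure Ω) [IsProbabilityMeasure μ]
    (Z D Y D' D1 D0 Y1 Y0 : Ω → ℝ)
    (h_meas_Z : Measurable Z)
    (h_meas_D : Measurable D)
    (h_meas_Y : Measurable Y)
    (h_meas_Dp : Measurable D')
    (h_meas_D1 : Measurable D1)
    (h_meas_D0 : Measurable D0)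
    (h_meas_Y1 : Measurable Y1)
    (h_meas_Y0 : Measurable Y0)
    (h_bin_Z : ∀ ω, Z ω = 0 ∨ Z ω = 1)
    (h_bin_Dp : ∀ ω, D' ω = 0 ∨ D' ω = 1)
    (h_bin_D1 : ∀ ω, D1 ω = 0 ∨ D1 ω = 1)
    (h_bin_D0 : ∀ ω, D0 ω = 0 ∨ D0 ω = 1)
    (h_bin_Y1 : ∀ ω, Y1 ω = 0 ∨ Y1 ω = 1)
    (h_bin_Y0 : ∀ ω, Y0 ω = 0 ∨ Y0 ω = 1)
    (h_consD : ∀ ω, D ω = Z ω * D1 ω + (1 - Z ω) * D0 ω)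
    (h_consY : ∀ ω, Y ω = Z ω * Y1 ω + (1 - Z ω) * Y0 ω)
    (h_indep : IndepFun Z (fun ω => (Y1 ω, Y0 ω, D1 ω, D0 ω)) μ)
    (h_mono : ∀ᵐ ω ∂μ, D0 ω ≤ D1 ω)
    (h_exclA : cpr μ {ω | D1 ω = 1 ∧ D0 ω = 1} {ω | Y1 ω = 1}
        = cpr μ {ω | D1 ω = 1 ∧ D0 ω = 1} {ω | Y0 ω = 1})
    (h_exclN : cpr μ {ω | D1 ω = 0 ∧ D0 ω = 0} {ω | Y1 ω = 1}
        = cpr μ {ω | D1 ω = 0 ∧ D0 ω = 0} {ω | Y0 ω = 1})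
    (h_ndD : ∀ d ∈ bin01, ∀ d' ∈ bin01, ∀ z ∈ bin01, ∀ d1 ∈ bin01, ∀ d0 ∈ bin01, ∀ y1 ∈ bin01, ∀ y0 ∈ bin01,
      μ ({ω | D ω = d} ∩ {ω | Z ω = z} ∩ {ω | D1 ω = d1} ∩ {ω | D0 ω = d0} ∩ {ω | Y1 ω = y1} ∩ {ω | Y0 ω = y0}) ≠ 0 →
      cpr μ ({ω | D ω = d} ∩ {ω | Z ω = z} ∩ {ω | D1 ω = d1} ∩ {ω | D0 ω = d0} ∩ {ω | Y1 ω = y1} ∩ {ω | Y0 ω = y0}) {ω | D' ω = d'}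
        = cpr μ {ω | D ω = d} {ω | D' ω = d'})
    (h_posZ : ∀ z ∈ bin01, μ {ω | Z ω = z} ≠ 0)
    (h_posD : ∀ d ∈ bin01, μ {ω | D ω = d} ≠ 0)
    (SND SPD : ℝ)
    (h_SND : SND = cpr μ {ω | D ω = 1} {ω | D' ω = 1})
    (h_SPD : SPD = cpr μ {ω | D ω = 0} {ω | D' ω = 0})
    (h_rD : SND + SPD - 1 ≠ 0)
    (h_Uc : 0 < pr μ {ω | D1 ω = 1 ∧ D0 ω = 0})
    (h_RDDp : (cpr μ {ω | Z ω = 1} {ω | D' ω = 1} - cpr μ {ω | Z ω = 0} {ω | D' ω = 1}) ≠ 0) :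
    cpr μ {ω | D1 ω = 1 ∧ D0 ω = 0} {ω | Y1 ω = 1}
      = (cpr μ {ω | Z ω = 1} ({ω | Y ω = 1} ∩ {ω | D' ω = 1}) - cpr μ {ω | Z ω = 0} ({ω | Y ω = 1} ∩ {ω | D' ω = 1})) / (cpr μ {ω | Z ω = 1} {ω | D' ω = 1} - cpr μ {ω | Z ω = 0} {ω | D' ω = 1}) - (1 - SPD) * (cpr μ {ω | Z ω = 1} {ω | Y ω = 1} - cpr μ {ω | Z ω = 0} {ω | Y ω = 1}) / (cpr μ {ω | Z ω = 1} {ω | D' ω = 1} - cpr μ {ω | Z ω = 0} {ω | D' ω = 1})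
    ∧ cpr μ {ω | D1 ω = 1 ∧ D0 ω = 0} {ω | Y0 ω = 1}
      = (cpr μ {ω | Z ω = 1} ({ω | Y ω = 1} ∩ {ω | D' ω = 1}) - cpr μ {ω | Z ω = 0} ({ω | Y ω = 1} ∩ {ω | D' ω = 1})) / (cpr μ {ω | Z ω = 1} {ω | D' ω = 1} - cpr μ {ω | Z ω = 0} {ω | D' ω = 1}) - SND * (cpr μ {ω | Z ω = 1} {ω | Y ω = 1} - cpr μ {ω | Z ω = 0} {ω | Y ω = 1}) / (cpr μ {ω | Z ω = 1} {ω | D' ω = 1} - cpr μ {ω | Z ω = 0} {ω | D' ω = 1}) := by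
  classical
  set V : Ω → ℝ × ℝ × ℝ × ℝ := fun ω => (Y1 ω, Y0 ω, D1 ω, D0 ω) with hVdef
  have hV : Measurable V := by fun_prop
  have hcells : ∀ ω, V ω ∈ cells := fun ω => by
    simp [hVdef, cells, h_bin_Y1 ω, h_bin_Y0 ω, h_bin_D1 ω, h_bin_D0 ω]
  set q : ℝ × ℝ × ℝ × ℝ → ℝ := fun v => pr μ (V ⁻¹' {v}) with hq
  set e : ℝ → ℝ := fun d => cpr μ {ω | D ω = d} {ω | D' ω = 1} with he
  have hZm : ∀ z, MeasurableSet {ω | Z ω = z} := fun z => h_meas_Z (measurableSet_singleton z)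
  have hUm : ∀ a b, MeasurableSet {ω | D1 ω = a ∧ D0 ω = b} := fun a b =>
    (h_meas_D1 (measurableSet_singleton a)).inter (h_meas_D0 (measurableSet_singleton b))
  have hcell : ∀ z v, pr μ ({ω | Z ω = z} ∩ V ⁻¹' {v}) = pr μ {ω | Z ω = z} * q v := by
    intro z v
    have := h_indep.measure_inter_preimage_eq_mul {z} {v} (measurableSet_singleton z)
      (measurableSet_singleton v)
    simp only [hq, pr, ← ENNReal.toReal_mul]
    exact congrArg ENNReal.toReal this
  have hcellD : ∀ z ∈ bin01, ∀ v ∈ cells,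
      pr μ ({ω | Z ω = z} ∩ V ⁻¹' {v} ∩ {ω | D' ω = 1})
        = pr μ {ω | Z ω = z} * (e (z * v.2.2.1 + (1 - z) * v.2.2.2) * q v) := by
    rintro z hz ⟨y1, y0, d1, d0⟩ hv
    simp only [cells, Finset.mem_product, Finset.mem_insert, Finset.mem_singleton] at hv
    obtain ⟨hy1, hy0, hd1, hd0⟩ := hv
    have hset : {ω | D ω = z * d1 + (1 - z) * d0} ∩ {ω | Z ω = z} ∩ {ω | D1 ω = d1}
        ∩ {ω | D0 ω = d0} ∩ {ω | Y1 ω = y1} ∩ {ω | Y0 ω = y0}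
        = {ω | Z ω = z} ∩ V ⁻¹' {(y1, y0, d1, d0)} := by
      ext ω
      simp only [hVdef, Set.mem_inter_iff, Set.mem_ofPred_eq, Set.mem_preimage,
        Set.mem_singleton_iff, Prod.mk.injEq]
      constructor
      · rintro ⟨⟨⟨⟨⟨-, h1⟩, h2⟩, h3⟩, h4⟩, h5⟩
        exact ⟨h1, h4, h5, h2, h3⟩
      · rintro ⟨h1, h4, h5, h2, h3⟩
        exact ⟨⟨⟨⟨⟨by rw [h_consD, h1, h2, h3], h1⟩, h2⟩, h3⟩, h4⟩, h5⟩
    by_cases h0 : μ ({ω | Z ω = z} ∩ V ⁻¹' {(y1, y0, d1, d0)}) = 0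
    · have h1 := hcell z (y1, y0, d1, d0)
      have h2 : pr μ ({ω | Z ω = z} ∩ V ⁻¹' {(y1, y0, d1, d0)}) = 0 := by simp [pr, h0]
      have h3 : pr μ ({ω | Z ω = z} ∩ V ⁻¹' {(y1, y0, d1, d0)} ∩ {ω | D' ω = 1}) = 0 := by
        simp [pr, measure_mono_null Set.inter_subset_left h0]
      rw [h3]
      linear_combination e (z * d1 + (1 - z) * d0) * (h1 - h2)
    · have hd : z * d1 + (1 - z) * d0 ∈ bin01 := by
        rcases hz with rfl | rfl <;> rcases hd1 with rfl | rfl <;> rcases hd0 with rfl | rfl <;>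
          simp [bin01]
      have h := h_ndD _ hd 1 (by simp [bin01]) z hz d1 hd1 d0 hd0 y1 hy1 y0 hy0
        (by rwa [hset])
      rw [hset, cpr_eq_div μ ((hZm z).inter (hV (measurableSet_singleton _))),
        div_eq_iff (pr_ne_zero μ h0), hcell] at h
      rw [h]
      ring
  have hY : ∀ z ∈ bin01, cpr μ {ω | Z ω = z} {ω | Y ω = 1}
      = ∑ v ∈ cells, if z * v.1 + (1 - z) * v.2.1 = 1 then q v else 0 := fun z hz =>
    cpr_eq_sum_cells μ hV hcells (hZm z) (h_posZ z hz) (A := Set.univ) _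
      (by rintro ω rfl; simp [hVdef, h_consY])
      (fun v _ => by rw [Set.inter_univ, hcell])
  have hD' : ∀ z ∈ bin01, cpr μ {ω | Z ω = z} {ω | D' ω = 1}
      = ∑ v ∈ cells, if True then e (z * v.2.2.1 + (1 - z) * v.2.2.2) * q v else 0 :=
    fun z hz => cpr_eq_sum_cells μ hV hcells (hZm z) (h_posZ z hz) (fun _ => True)
      (by simp) (hcellD z hz)
  have hYD' : ∀ z ∈ bin01, cpr μ {ω | Z ω = z} ({ω | Y ω = 1} ∩ {ω | D' ω = 1})
      = ∑ v ∈ cells, if z * v.1 + (1 - z) * v.2.1 = 1 then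
          e (z * v.2.2.1 + (1 - z) * v.2.2.2) * q v else 0 := fun z hz =>
    cpr_eq_sum_cells μ hV hcells (hZm z) (h_posZ z hz) (A := {ω | D' ω = 1}) _
      (by rintro ω rfl; simp [hVdef, h_consY]) (hcellD z hz)
  have hdef : ∀ y1 y0, q (y1, y0, 0, 1) = 0 := by
    intro y1 y0
    have hnull : μ (V ⁻¹' {(y1, y0, 0, 1)}) = 0 := by
      refine measure_mono_null (fun ω hω => ?_) (ae_iff.1 h_mono)
      simp only [hVdef, Set.mem_preimage, Set.mem_singleton_iff, Prod.mk.injEq] at hω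
      simp [hω.2.2.1, hω.2.2.2]
    simp [hq, pr, hnull]
  have hUY1 : ∀ a b, pr μ ({ω | D1 ω = a ∧ D0 ω = b} ∩ {ω | Y1 ω = 1})
      = ∑ v ∈ cells, if (v.2.2.1 = a ∧ v.2.2.2 = b) ∧ v.1 = 1 then q v else 0 := fun a b =>
    pr_setOf_eq_sum_cells μ hV hcells fun v => (v.2.2.1 = a ∧ v.2.2.2 = b) ∧ v.1 = 1
  have hUY0 : ∀ a b, pr μ ({ω | D1 ω = a ∧ D0 ω = b} ∩ {ω | Y0 ω = 1})
      = ∑ v ∈ cells, if (v.2.2.1 = a ∧ v.2.2.2 = b) ∧ v.2.1 = 1 then q v else 0 := fun a b =>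
    pr_setOf_eq_sum_cells μ hV hcells fun v => (v.2.2.1 = a ∧ v.2.2.2 = b) ∧ v.2.1 = 1
  have hU : pr μ {ω | D1 ω = 1 ∧ D0 ω = 0}
      = ∑ v ∈ cells, if v.2.2.1 = 1 ∧ v.2.2.2 = 0 then q v else 0 :=
    pr_setOf_eq_sum_cells μ hV hcells fun v => v.2.2.1 = 1 ∧ v.2.2.2 = 0
  have hA := pr_inter_eq_of_cpr_eq μ (hUm 1 1) h_exclA
  have hN := pr_inter_eq_of_cpr_eq μ (hUm 0 0) h_exclN
  have he1 : e 1 = SND := h_SND.symm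
  have he0 : e 0 = 1 - SPD := by
    rw [h_SPD]
    exact cpr_compl_binary μ (h_posD 0 (by simp [bin01])) h_meas_Dp h_bin_Dp
  have hz0 : (0 : ℝ) ∈ bin01 := by simp [bin01]
  have hz1 : (1 : ℝ) ∈ bin01 := by simp [bin01]
  rw [hUY1, hUY0] at hA hN
  rw [hU] at h_Uc
  rw [hD' 1 hz1, hD' 0 hz0] at h_RDDp ⊢
  rw [cpr_eq_div μ (hUm 1 0), cpr_eq_div μ (hUm 1 0), hUY1, hUY0, hU, hY 1 hz1, hY 0 hz0,
    hYD' 1 hz1, hYD' 0 hz0]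
  clear_value q e
  simp only [sum_cells] at hA hN h_Uc h_RDDp ⊢
  simp only [he0, he1, hdef, mul_zero, mul_one, zero_add, add_zero, sub_zero,
    sub_self, one_ne_zero, zero_ne_one, and_self, and_true, and_false,
    if_true, if_false] at hA hN h_Uc h_RDDp ⊢
  rw [← sub_div, ← sub_div, div_eq_div_iff h_Uc.ne' h_RDDp, div_eq_div_iff h_Uc.ne' h_RDDp]
  set c := q (0, 0, 1, 0) + q (0, 1, 1, 0) + q (1, 0, 1, 0) + q (1, 1, 1, 0) with hc
  constructor
  · linear_combination (q (1, 0, 1, 0) + q (1, 1, 1, 0)) * (1 - SND - SPD) * hc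
      - c * (SND + SPD - 1) * hA
  · linear_combination (q (0, 1, 1, 0) + q (1, 1, 1, 0)) * (1 - SND - SPD) * hc
      + c * (SND + SPD - 1) * hN
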